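/- For each pair {i, j} ∈ {{1,2}, {4,5}, {1,3}, {3,5}, {1,4}, {2,5}, {2,4}} and every integer n ≥ 2, the number of ≡_{i,j}-equivalence classes of binary trees of arity n equals 2^{n−2}. -/

import Mathlib

/-- A binary tree: either a leaf or an ordered pair of binary trees. -/
inductive BTree : Type
  | leaf : BTree
  | node : BTree → BTree → BTree
  deriving DecidableEq

namespace BTree

/-- The arity of a binary tree is its number of leaves. -/
def arity : BTree → ℕ
  | leaf => 1
  | node l r => arity l + arity r

/-- The degree of a binary tree is its number of internal nodes. -/
def degree : BTree → ℕ
  | leaf => 0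
  | node l r => degree l + degree r + 1

/-- Grafting `t ∘ᵢ s`: identify the root of `s` with the `i`-th leaf of `t`
(leaves numbered from left to right, starting at `1`). -/
def graft : BTree → ℕ → BTree → BTree
  | leaf, i, s => if i = 1 then s else leaf
  | node l r, i, s =>
      if i ≤ l.arity then node (l.graft i s) r else node l (r.graft (i - l.arity) s)

/-- Simultaneous grafting `s ∘ [r_1, …, r_n]`: graft the `i`-th element of the
list onto the `i`-th leaf of `s`, simultaneously. -/
def multigraft : BTree → List BTree → BTree
  | leaf, rs => rs.headD leaf
  | node l r, rs => node (l.multigraft (rs.take l.arity)) (r.multigraft (rs.drop l.arity))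

/-- The left comb with `γ` internal nodes. -/
def leftComb : ℕ → BTree
  | 0 => leaf
  | γ + 1 => node (leftComb γ) leaf

/-- The right comb with `γ` internal nodes. -/
def rightComb : ℕ → BTree
  | 0 => leaf
  | γ + 1 => node leaf (rightComb γ)

/-- The prefix word of a binary tree, over the alphabet `{0, 2}`:
a left-to-right depth-first traversal writes `2` for each internal node and
`0` for each leaf. -/
def prefixWord : BTree → List ℕ
  | leaf => [0]
  | node l r => 2 :: (prefixWord l ++ prefixWord r)

/-- The left rank: number of internal nodes on the leftmost branch from the root. -/
def leftRank : BTree → ℕ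
  | leaf => 0
  | node l _ => leftRank l + 1

/-- The mirror of a binary tree. -/
def mirror : BTree → BTree
  | leaf => leaf
  | node l r => node (mirror r) (mirror l)

end BTree

/-- One step of the rewrite relation induced by a set of rewrite rules `R`:
`r ∘ᵢ (s ∘ [r_1, …, r_n]) ⇒ r ∘ᵢ (s' ∘ [r_1, …, r_n])` whenever `R s s'`. -/
def Step (R : BTree → BTree → Prop) (t t' : BTree) : Prop :=
  ∃ (s s' r : BTree) (i : ℕ) (rs : List BTree),
    R s s' ∧ 1 ≤ i ∧ i ≤ r.arity ∧ rs.length = s.arity ∧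
    t = r.graft i (s.multigraft rs) ∧ t' = r.graft i (s'.multigraft rs)

/-- The congruence generated by a set of rewrite rules: the reflexive–symmetric–transitive
closure of the induced rewrite relation. -/
def CongrGen (R : BTree → BTree → Prop) : BTree → BTree → Prop :=
  Relation.EqvGen (Step R)

/-- The tree `s` occurs as a subtree of `t`. -/
def Occurs (s t : BTree) : Prop :=
  ∃ (r : BTree) (i : ℕ) (rs : List BTree),
    1 ≤ i ∧ i ≤ r.arity ∧ rs.length = s.arity ∧ t = r.graft i (s.multigraft rs)

/-- The rewrite relation induced by `R` is terminating: there is no infinite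
chain `t_0 ⇒ t_1 ⇒ t_2 ⇒ ⋯`. -/
def Terminating (R : BTree → BTree → Prop) : Prop :=
  ¬ ∃ f : ℕ → BTree, ∀ n, Step R (f n) (f (n + 1))

/-- The rewrite relation induced by `R` is confluent. -/
def Confluent (R : BTree → BTree → Prop) : Prop :=
  ∀ t s₁ s₂, Relation.ReflTransGen (Step R) t s₁ → Relation.ReflTransGen (Step R) t s₂ →
    ∃ t', Relation.ReflTransGen (Step R) s₁ t' ∧ Relation.ReflTransGen (Step R) s₂ t'

/-- The number of equivalence classes of binary trees of arity `n` under the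
equivalence relation `E`. -/
noncomputable def classCount (E : BTree → BTree → Prop) (n : ℕ) : ℕ :=
  Nat.card (Quot fun a b : {t : BTree // t.arity = n} => E a.1 b.1)

/-- The congruence `≡_γ` generated by the single rewrite rule `(L_γ, R_γ)`. -/
def CAsCongr (γ : ℕ) : BTree → BTree → Prop :=
  CongrGen fun s s' => s = BTree.leftComb γ ∧ s' = BTree.rightComb γ

/-- The five binary trees of degree `3`, in increasing lexicographic order of
their prefix words: `cubic 1` has prefix word `2020200` (the right comb), …,
`cubic 5` has prefix word `2220000` (the left comb). -/
def cubic : ℕ → BTree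
  | 1 => .node .leaf (.node .leaf (.node .leaf .leaf))
  | 2 => .node .leaf (.node (.node .leaf .leaf) .leaf)
  | 3 => .node (.node .leaf .leaf) (.node .leaf .leaf)
  | 4 => .node (.node .leaf (.node .leaf .leaf)) .leaf
  | 5 => .node (.node (.node .leaf .leaf) .leaf) .leaf
  | _ => .leaf

/-- The congruence `≡_{i,j}` generated by the single rewrite rule `(𝔞_i, 𝔞_j)`. -/
def MagCongr (i j : ℕ) : BTree → BTree → Prop :=
  CongrGen fun s s' => s = cubic i ∧ s' = cubic j

open BTree

namespace MagCongr

variable {i j : ℕ}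

theorem refl (t : BTree) : MagCongr i j t t := Relation.EqvGen.refl t

theorem symm {t t' : BTree} (h : MagCongr i j t t') : MagCongr i j t' t :=
  Relation.EqvGen.symm _ _ h

theorem trans {t t' t'' : BTree} (h : MagCongr i j t t') (h' : MagCongr i j t' t'') :
    MagCongr i j t t'' :=
  Relation.EqvGen.trans _ _ _ h h'

theorem node_left {t t' : BTree} (u : BTree) (h : MagCongr i j t t') :
    MagCongr i j (node t u) (node t' u) := by
  induction h with
  | refl t => exact refl _
  | symm _ _ _ ih => exact ih.symm
  | trans _ _ _ _ _ ih₁ ih₂ => exact ih₁.trans ih₂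
  | rel t t' h =>
    obtain ⟨s, s', r, k, rs, hR, hk, hkr, hrs, rfl, rfl⟩ := h
    refine Relation.EqvGen.rel _ _ ⟨s, s', node r u, k, rs, hR, hk, ?_, hrs, ?_, ?_⟩
    · simp only [arity]; omega
    · simp [graft, hkr]
    · simp [graft, hkr]

theorem node_right {t t' : BTree} (u : BTree) (h : MagCongr i j t t') :
    MagCongr i j (node u t) (node u t') := by
  induction h with
  | refl t => exact refl _
  | symm _ _ _ ih => exact ih.symm
  | trans _ _ _ _ _ ih₁ ih₂ => exact ih₁.trans ih₂
  | rel t t' h =>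
    obtain ⟨s, s', r, k, rs, hR, hk, hkr, hrs, rfl, rfl⟩ := h
    have hlt : ¬ k + u.arity ≤ u.arity := by omega
    refine Relation.EqvGen.rel _ _ ⟨s, s', node u r, k + u.arity, rs, hR, ?_, ?_, hrs, ?_, ?_⟩
    · omega
    · simp only [arity]; omega
    · simp [graft, hlt]
    · simp [graft, hlt]

theorem node_congr {l l' r r' : BTree} (hl : MagCongr i j l l') (hr : MagCongr i j r r') :
    MagCongr i j (node l r) (node l' r') :=
  (hl.node_left _).trans (hr.node_right _)

/-- The defining relation of `MagCongr i j`, at the root of a tree. -/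
theorem rule (hi : (cubic i).arity = 4) (x y z w : BTree) :
    MagCongr i j ((cubic i).multigraft [x, y, z, w]) ((cubic j).multigraft [x, y, z, w]) :=
  Relation.EqvGen.rel _ _
    ⟨cubic i, cubic j, leaf, 1, [x, y, z, w], ⟨rfl, rfl⟩, le_rfl, le_rfl, by simp [hi],
      by simp [graft], by simp [graft]⟩

/-- `MagCongr i j` is contained in every equivalence relation compatible with `node` which
contains the instances of its defining relation. -/
theorem lift (hi : (cubic i).arity = 4) {S : BTree → BTree → Prop} (hS : Equivalence S)
    (hnode : ∀ l l' r r', S l l' → S r r' → S (node l r) (node l' r'))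
    (hrule : ∀ x y z w,
      S ((cubic i).multigraft [x, y, z, w]) ((cubic j).multigraft [x, y, z, w]))
    {t t' : BTree} (h : MagCongr i j t t') : S t t' := by
  have hgraft : ∀ (r s s' : BTree) (k : ℕ), S s s' → S (r.graft k s) (r.graft k s') := by
    intro r s s'
    induction r with
    | leaf =>
      intro k h
      unfold graft
      split_ifs
      exacts [h, hS.refl _]
    | node l r ihl ihr =>
      intro k h
      unfold graft
      split_ifs
      exacts [hnode _ _ _ _ (ihl _ h) (hS.refl _), hnode _ _ _ _ (hS.refl _) (ihr _ h)]
  induction h with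
  | refl t => exact hS.refl _
  | symm _ _ _ ih => exact hS.symm ih
  | trans _ _ _ _ _ ih₁ ih₂ => exact hS.trans ih₁ ih₂
  | rel t t' h =>
    obtain ⟨s, s', r, k, rs, ⟨rfl, rfl⟩, -, -, hrs, rfl, rfl⟩ := h
    rw [hi] at hrs
    obtain ⟨x, y, z, w, rfl⟩ := List.length_eq_four.mp hrs
    exact hgraft _ _ _ _ (hrule x y z w)

end MagCongr

section Mirror

theorem BTree.mirror_mirror (t : BTree) : t.mirror.mirror = t := by
  induction t with
  | leaf => rfl
  | node l r ihl ihr => simp [mirror, ihl, ihr]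

theorem BTree.arity_mirror (t : BTree) : t.mirror.arity = t.arity := by
  induction t with
  | leaf => rfl
  | node l r ihl ihr => simp [mirror, arity, ihl, ihr, add_comm]

theorem one_le_and_le_five_of_arity_cubic {i : ℕ} (hi : (cubic i).arity = 4) :
    1 ≤ i ∧ i ≤ 5 := by
  unfold cubic at hi
  split at hi <;> simp_all [arity]

theorem mirror_cubic_multigraft {i : ℕ} (hi : (cubic i).arity = 4) (x y z w : BTree) :
    ((cubic i).multigraft [x, y, z, w]).mirror =
      (cubic (6 - i)).multigraft [w.mirror, z.mirror, y.mirror, x.mirror] := by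
  obtain ⟨h₁, h₂⟩ := one_le_and_le_five_of_arity_cubic hi
  interval_cases i <;> simp [cubic, multigraft, mirror, arity]

theorem MagCongr.mirror {i j : ℕ} (hi : (cubic i).arity = 4) (hj : (cubic j).arity = 4)
    {t t' : BTree} (h : MagCongr i j t t') :
    MagCongr (6 - j) (6 - i) t.mirror t'.mirror := by
  refine MagCongr.lift (S := fun t t' => MagCongr (6 - j) (6 - i) t.mirror t'.mirror) hi
    ⟨fun _ => .refl _, fun h => h.symm, fun h h' => h.trans h'⟩
    (fun _ _ _ _ hl hr => hr.node_congr hl) (fun x y z w => ?_) h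
  rw [mirror_cubic_multigraft hi, mirror_cubic_multigraft hj]
  refine (MagCongr.rule ?_ _ _ _ _).symm
  obtain ⟨h₁, h₂⟩ := one_le_and_le_five_of_arity_cubic hj
  interval_cases j <;> rfl

theorem classCount_mirror {i j : ℕ} (hi : (cubic i).arity = 4) (hj : (cubic j).arity = 4)
    (hi' : (cubic (6 - i)).arity = 4) (hj' : (cubic (6 - j)).arity = 4) (n : ℕ) :
    classCount (MagCongr (6 - j) (6 - i)) n = classCount (MagCongr i j) n := by
  obtain ⟨hi₁, hi₂⟩ := one_le_and_le_five_of_arity_cubic hi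
  obtain ⟨hj₁, hj₂⟩ := one_le_and_le_five_of_arity_cubic hj
  let e : {t : BTree // t.arity = n} ≃ {t : BTree // t.arity = n} :=
    { toFun := fun t => ⟨t.1.mirror, by rw [arity_mirror, t.2]⟩
      invFun := fun t => ⟨t.1.mirror, by rw [arity_mirror, t.2]⟩
      left_inv := fun t => Subtype.ext (mirror_mirror _)
      right_inv := fun t => Subtype.ext (mirror_mirror _) }
  refine (Nat.card_congr (Quot.congr e fun a b => ⟨fun h => h.mirror hi hj, fun h => ?_⟩)).symm
  have h' := MagCongr.mirror hj' hi' h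
  rw [Nat.sub_sub_self (by omega), Nat.sub_sub_self (by omega)] at h'
  simpa [e, mirror_mirror] using h'

end Mirror

section Codes

/-- The arity encoded by a code: `none` encodes the leaf, and `some w` a tree of arity
`w.length + 2`. -/
def codeArity : Option (List Bool) → ℕ
  | none => 1
  | some w => w.length + 2

theorem codeArity_some (w : List Bool) : codeArity (some w) = w.length + 2 := rfl

/-- The code of a tree, given the code of a product in terms of the codes of its factors. -/
def code (op : Option (List Bool) → Option (List Bool) → List Bool) : BTree → Option (List Bool)
  | leaf => none
  | node l r => some (op (code op l) (code op r))

/-- Extend a decoding of words to codes. -/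
def decode (dec : List Bool → BTree) : Option (List Bool) → BTree
  | none => leaf
  | some w => dec w

variable {op : Option (List Bool) → Option (List Bool) → List Bool}

theorem codeArity_code (hlen : ∀ a b, (op a b).length + 2 = codeArity a + codeArity b)
    (t : BTree) : codeArity (code op t) = t.arity := by
  induction t with
  | leaf => rfl
  | node l r ihl ihr => rw [arity, ← ihl, ← ihr, ← hlen]; rfl

/-- If words encode normal forms for `MagCongr i j`, and `op` computes the normal form of a
product, then there are `2 ^ (n - 2)` classes of trees of arity `n`. -/
theorem classCount_eq_of_code {i j : ℕ} (hi : (cubic i).arity = 4) (dec : List Bool → BTree)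
    (hlen : ∀ a b, (op a b).length + 2 = codeArity a + codeArity b)
    (hrule : ∀ x y z w, code op ((cubic i).multigraft [x, y, z, w]) =
      code op ((cubic j).multigraft [x, y, z, w]))
    (hdec : ∀ w, code op (dec w) = some w)
    (hred : ∀ a b, MagCongr i j (node (decode dec a) (decode dec b)) (dec (op a b)))
    {n : ℕ} (hn : 2 ≤ n) : classCount (MagCongr i j) n = 2 ^ (n - 2) := by
  have hnf (t : BTree) : MagCongr i j t (decode dec (code op t)) := by
    induction t with
    | leaf => exact .refl _
    | node l r ihl ihr => exact (ihl.node_congr ihr).trans (hred _ _)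
  have hcode {t t' : BTree} (h : MagCongr i j t t') : code op t = code op t' :=
    MagCongr.lift (S := fun t t' => code op t = code op t') hi
      ⟨fun _ => rfl, fun h => h.symm, fun h h' => h.trans h'⟩
      (fun _ _ _ _ hl hr => by simp only [code, hl, hr]) hrule h
  have harity (w : List Bool) : (dec w).arity = w.length + 2 := by
    rw [← codeArity_code hlen, hdec, codeArity]
  let f : List.Vector Bool (n - 2) → Quot fun a b : {t : BTree // t.arity = n} =>
      MagCongr i j a.1 b.1 :=
    fun w => Quot.mk _ ⟨dec w.1, by rw [harity, w.2]; omega⟩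
  have hf : f.Bijective := by
    constructor
    · intro v w hvw
      have h : code op (dec v.1) = code op (dec w.1) :=
        congrArg (Quot.lift (fun t : {t : BTree // t.arity = n} => code op t.1)
          fun _ _ h => hcode h) hvw
      rw [hdec, hdec, Option.some_inj] at h
      exact Subtype.ext h
    · rintro ⟨t, ht⟩
      have h := codeArity_code hlen t
      have ht' := hnf t
      cases hc : code op t with
      | none => rw [hc, codeArity] at h; omega
      | some w =>
        rw [hc, codeArity] at h
        rw [hc] at ht'
        exact ⟨⟨w, by omega⟩, Quot.sound ht'.symm⟩
  rw [classCount, ← Nat.card_eq_of_bijective f hf, Nat.card_eq_fintype_card, card_vector,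
    Fintype.card_bool]

end Codes

section AvoidThree

/-- Decoding of the normal forms avoiding `cubic 3`. -/
def decAvoidThree : List Bool → BTree
  | [] => node leaf leaf
  | false :: w => node leaf (decAvoidThree w)
  | true :: w => node (decAvoidThree w) leaf

/-- Product of codes modulo `cubic 1 = cubic 3`. -/
def opOneThree : Option (List Bool) → Option (List Bool) → List Bool
  | none, none => []
  | some v, none => true :: v
  | a, some w => List.replicate (codeArity a) false ++ w

theorem opOneThree_some (a : Option (List Bool)) (w : List Bool) :
    opOneThree a (some w) = List.replicate (codeArity a) false ++ w := by
  cases a <;> rfl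

theorem length_opOneThree (a b : Option (List Bool)) :
    (opOneThree a b).length + 2 = codeArity a + codeArity b := by
  rcases a with _ | v <;> rcases b with _ | w <;> simp [opOneThree, codeArity] <;> omega

/-- Multiply a tree `k` times by a leaf on the left. -/
def padLeft (u : BTree) : ℕ → BTree
  | 0 => u
  | k + 1 => node leaf (padLeft u k)

theorem padLeft_add (u : BTree) (k l : ℕ) : padLeft (padLeft u l) k = padLeft u (k + l) := by
  induction k with
  | zero => simp [padLeft]
  | succ k ih => rw [Nat.succ_add, padLeft, padLeft, ih]

theorem exists_padLeft_node (a b : BTree) (k : ℕ) : ∃ a' b', padLeft (node a b) k = node a' b' := by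
  cases k
  exacts [⟨_, _, rfl⟩, ⟨_, _, rfl⟩]

theorem exists_decAvoidThree (w : List Bool) : ∃ a b, decAvoidThree w = node a b := by
  rcases w with _ | ⟨_ | _, w⟩
  exacts [⟨_, _, rfl⟩, ⟨_, _, rfl⟩, ⟨_, _, rfl⟩]

theorem decAvoidThree_replicate_append (k : ℕ) (w : List Bool) :
    decAvoidThree (List.replicate k false ++ w) = padLeft (decAvoidThree w) k := by
  induction k with
  | zero => rfl
  | succ k ih => rw [List.replicate_succ, List.cons_append, decAvoidThree, ih, padLeft]

theorem magCongr_one_three_padLeft (t a b : BTree) :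
    MagCongr 1 3 (node t (node a b)) (padLeft (node a b) t.arity) := by
  induction t generalizing a b with
  | leaf => exact .refl _
  | node l r ihl ihr =>
    have h : MagCongr 1 3 (node l (node r (node a b))) (node (node l r) (node a b)) :=
      MagCongr.rule (i := 1) (j := 3) rfl l r a b
    refine h.symm.trans (((ihr a b).node_right l).trans ?_)
    obtain ⟨a', b', h'⟩ := exists_padLeft_node a b r.arity
    rw [arity, ← padLeft_add, h']
    exact ihl a' b'

theorem code_decAvoidThree (w : List Bool) : code opOneThree (decAvoidThree w) = some w := by
  induction w with
  | nil => rfl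
  | cons c w ih => cases c <;> simp [decAvoidThree, code, ih, opOneThree, codeArity]

theorem classCount_one_three {n : ℕ} (hn : 2 ≤ n) :
    classCount (MagCongr 1 3) n = 2 ^ (n - 2) := by
  refine classCount_eq_of_code rfl decAvoidThree length_opOneThree (fun x y z w => ?_)
    code_decAvoidThree (fun a b => ?_) hn
  · have h := length_opOneThree (code opOneThree x) (code opOneThree y)
    simp only [cubic, multigraft, code, arity, List.take, List.drop, List.headD, opOneThree_some,
      codeArity_some, h, ← List.append_assoc, List.replicate_append_replicate]
  · rcases b with _ | w
    · rcases a with _ | v <;> exact .refl _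
    · have harity : (decode decAvoidThree a).arity = codeArity a := by
        rw [← codeArity_code length_opOneThree]
        cases a
        · rfl
        · rw [decode, code_decAvoidThree]
      rw [opOneThree_some, decAvoidThree_replicate_append, ← harity]
      obtain ⟨p, q, h⟩ := exists_decAvoidThree w
      simp only [decode, h]
      exact magCongr_one_three_padLeft _ _ _

end AvoidThree

section AvoidFour

/-- The contribution of the right factor to the code of a product. -/
def codeTail : Option (List Bool) → List Bool
  | none => []
  | some w => false :: w

theorem length_codeTail (b : Option (List Bool)) : (codeTail b).length + 1 = codeArity b := by
  cases b <;> rfl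

/-- Decoding of the normal forms avoiding `cubic 4`, which are the trees all of whose left
subtrees are left combs; the first argument is the size of the current left comb. -/
def decAvoidFour : ℕ → List Bool → BTree
  | k, [] => node (leftComb k) leaf
  | k, true :: w => decAvoidFour (k + 1) w
  | k, false :: w => node (leftComb k) (decAvoidFour 0 w)

theorem decAvoidFour_codeTail (k : ℕ) (b : Option (List Bool)) :
    decAvoidFour k (codeTail b) = node (leftComb k) (decode (decAvoidFour 0) b) := by
  cases b <;> rfl

theorem decAvoidFour_replicate_append (k l : ℕ) (w : List Bool) :
    decAvoidFour k (List.replicate l true ++ w) = decAvoidFour (k + l) w := by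
  induction l generalizing k with
  | zero => rfl
  | succ l ih =>
    rw [List.replicate_succ, List.cons_append, decAvoidFour, ih, Nat.add_right_comm, Nat.add_assoc]

theorem exists_decAvoidFour (k : ℕ) (w : List Bool) : ∃ a b, decAvoidFour k w = node a b := by
  induction w generalizing k with
  | nil => exact ⟨_, _, rfl⟩
  | cons c w ih =>
    cases c
    exacts [⟨_, _, rfl⟩, ih _]

theorem code_decAvoidFour {op : Option (List Bool) → Option (List Bool) → List Bool}
    (hop : ∀ k b, op (code op (leftComb k)) b = List.replicate k true ++ codeTail b)
    (k : ℕ) (w : List Bool) :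
    code op (decAvoidFour k w) = some (List.replicate k true ++ w) := by
  induction w generalizing k with
  | nil => simp [decAvoidFour, code, hop, codeTail]
  | cons c w ih =>
    cases c
    · simp [decAvoidFour, code, hop, ih, codeTail]
    · simp [decAvoidFour, ih, List.replicate_succ', List.append_assoc]

/-- Product of codes modulo `cubic 4 = cubic 5`. -/
def opFourFive (a b : Option (List Bool)) : List Bool :=
  List.replicate (codeArity a - 1) true ++ codeTail b

theorem one_le_codeArity (a : Option (List Bool)) : 1 ≤ codeArity a := by
  cases a <;> simp [codeArity]

theorem length_opFourFive (a b : Option (List Bool)) :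
    (opFourFive a b).length + 2 = codeArity a + codeArity b := by
  have h := one_le_codeArity a
  have h' := length_codeTail b
  simp only [opFourFive, List.length_append, List.length_replicate]
  omega

theorem arity_leftComb (k : ℕ) : (leftComb k).arity = k + 1 := by
  induction k with
  | zero => rfl
  | succ k ih => rw [leftComb, arity, ih, arity]

theorem opFourFive_leftComb (k : ℕ) (b : Option (List Bool)) :
    opFourFive (code opFourFive (leftComb k)) b = List.replicate k true ++ codeTail b := by
  rw [opFourFive, codeArity_code length_opFourFive, arity_leftComb, Nat.add_sub_cancel]

/-- Multiply a tree `k` times by a leaf on the right. -/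
def padRight (u : BTree) : ℕ → BTree
  | 0 => u
  | k + 1 => node (padRight u k) leaf

theorem padRight_add (u : BTree) (k l : ℕ) : padRight (padRight u l) k = padRight u (l + k) := by
  induction k with
  | zero => rfl
  | succ k ih => rw [← Nat.add_assoc, padRight, padRight, ih]

theorem padRight_leftComb (k l : ℕ) : padRight (leftComb k) l = leftComb (k + l) := by
  induction l with
  | zero => rfl
  | succ l ih => rw [← Nat.add_assoc, padRight, leftComb, ih]

theorem magCongr_four_five_padRight (x t u : BTree) :
    MagCongr 4 5 (node (node x t) u) (node (padRight x t.arity) u) := by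
  induction t generalizing x u with
  | leaf => exact .refl _
  | node y z ihy ihz =>
    have h : MagCongr 4 5 (node (node x (node y z)) u) (node (node (node x y) z) u) :=
      MagCongr.rule (i := 4) (j := 5) rfl x y z u
    refine h.trans (((ihy x z).node_left u).trans ?_)
    rw [arity, ← padRight_add]
    exact ihz _ _

theorem one_le_arity (t : BTree) : 1 ≤ t.arity := by
  induction t with
  | leaf => exact le_rfl
  | node l r ihl ihr => rw [arity]; omega

theorem magCongr_four_five_leftComb (t u : BTree) :
    MagCongr 4 5 (node t u) (node (leftComb (t.arity - 1)) u) := by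
  induction t generalizing u with
  | leaf => exact .refl _
  | node x y ihx _ =>
    refine ((ihx y).node_left u).trans ((magCongr_four_five_padRight _ _ _).trans ?_)
    have h := one_le_arity x
    rw [padRight_leftComb, arity, Nat.sub_add_comm h]
    exact .refl _

theorem classCount_four_five {n : ℕ} (hn : 2 ≤ n) :
    classCount (MagCongr 4 5) n = 2 ^ (n - 2) := by
  have hdec (w : List Bool) : code opFourFive (decAvoidFour 0 w) = some w :=
    code_decAvoidFour opFourFive_leftComb 0 w
  refine classCount_eq_of_code rfl (decAvoidFour 0) length_opFourFive (fun x y z w => ?_)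
    hdec (fun a b => ?_) hn
  · simp only [cubic, multigraft, code, arity, List.take, List.drop, List.headD]
    refine congrArg (fun m => some (List.replicate (m - 1) true ++ codeTail (code opFourFive w))) ?_
    simp only [codeArity_some, length_opFourFive, Nat.add_assoc]
  · have harity : (decode (decAvoidFour 0) a).arity = codeArity a := by
      rw [← codeArity_code length_opFourFive]
      cases a
      · rfl
      · rw [decode, hdec]
    rw [opFourFive, decAvoidFour_replicate_append, decAvoidFour_codeTail, ← harity, Nat.zero_add]
    exact magCongr_four_five_leftComb _ _

/-- Product of codes in which a letter depending on the left factor is inserted. -/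
def opInsert (c : List Bool → Bool) : Option (List Bool) → Option (List Bool) → List Bool
  | none, b => codeTail b
  | some v, b => v ++ c v :: codeTail b

theorem length_opInsert (c : List Bool → Bool) (a b : Option (List Bool)) :
    (opInsert c a b).length + 2 = codeArity a + codeArity b := by
  have h := length_codeTail b
  cases a with
  | none => rw [opInsert, ← h, codeArity]; omega
  | some v =>
    rw [opInsert, ← h, codeArity_some, List.length_append, List.length_cons]
    omega

theorem opInsert_leftComb {c : List Bool → Bool} (hc : ∀ k, c (List.replicate k true) = true)
    (k : ℕ) (b : Option (List Bool)) :
    opInsert c (code (opInsert c) (leftComb k)) b = List.replicate k true ++ codeTail b := by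
  induction k generalizing b with
  | zero => rfl
  | succ k ih =>
    rw [leftComb, code, opInsert, code, ih, codeTail, List.append_nil, hc, List.replicate_succ',
      List.append_assoc, List.singleton_append]

theorem magCongr_two_four_decAvoidFour (k : ℕ) (w : List Bool) (b : Option (List Bool)) :
    MagCongr 2 4 (node (decAvoidFour k w) (decode (decAvoidFour 0) b))
      (decAvoidFour k (w ++ true :: codeTail b)) := by
  induction w generalizing k with
  | nil =>
    rw [List.nil_append, decAvoidFour, decAvoidFour, decAvoidFour_codeTail]
    exact .refl _
  | cons c w ih =>
    cases c
    · rw [List.cons_append, decAvoidFour, decAvoidFour]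
      refine MagCongr.trans ?_ ((ih 0).node_right _)
      obtain ⟨p, q, h⟩ := exists_decAvoidFour 0 w
      rw [h]
      exact (MagCongr.rule (i := 2) (j := 4) rfl _ p q _).symm
    · exact ih (k + 1)

theorem classCount_two_four {n : ℕ} (hn : 2 ≤ n) :
    classCount (MagCongr 2 4) n = 2 ^ (n - 2) := by
  refine classCount_eq_of_code (op := opInsert fun _ => true) rfl (decAvoidFour 0)
    (length_opInsert _) (fun x y z w => ?_) (code_decAvoidFour (opInsert_leftComb fun _ => rfl) 0)
    (fun a b => ?_) hn
  · simp only [cubic, multigraft, code, arity, List.take, List.drop, List.headD]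
    cases code (opInsert fun _ => true) x <;> simp [opInsert, codeTail]
  · cases a with
    | none =>
      rw [opInsert, decAvoidFour_codeTail]
      exact .refl _
    | some v => exact magCongr_two_four_decAvoidFour 0 v b

/-- Whether a word has an even number of letters `false`. -/
def evenFalse : List Bool → Bool
  | [] => true
  | true :: w => evenFalse w
  | false :: w => !evenFalse w

theorem evenFalse_append (v w : List Bool) :
    evenFalse (v ++ w) = (evenFalse v == evenFalse w) := by
  induction v with
  | nil => simp [evenFalse]
  | cons c v ih =>
    cases c <;> simp only [List.cons_append, evenFalse, ih]
    cases evenFalse v <;> cases evenFalse w <;> rfl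

theorem evenFalse_replicate_true (k : ℕ) : evenFalse (List.replicate k true) = true := by
  induction k with
  | zero => rfl
  | succ k ih => rw [List.replicate_succ, evenFalse, ih]

theorem opInsert_evenFalse_rule (a b c d : Option (List Bool)) :
    opInsert evenFalse a (some (opInsert evenFalse b (some (opInsert evenFalse c d)))) =
      opInsert evenFalse (some (opInsert evenFalse a (some (opInsert evenFalse b c)))) d := by
  have hself (v : List Bool) : evenFalse (v ++ [evenFalse v]) = true := by
    rw [evenFalse_append]; cases evenFalse v <;> rfl
  have hprefix (a : Option (List Bool)) : ∃ v, evenFalse v = true ∧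
      ∀ b, opInsert evenFalse a b = v ++ codeTail b := by
    cases a with
    | none => exact ⟨[], rfl, fun b => rfl⟩
    | some v => exact ⟨v ++ [evenFalse v], hself v, fun b => by simp [opInsert]⟩
  obtain ⟨u, hu, hu'⟩ := hprefix a
  obtain ⟨v, hv, hv'⟩ := hprefix b
  rw [hu', hu', hv', hv', opInsert]
  cases c <;> simp [opInsert, codeTail, evenFalse_append, evenFalse, hu, hv]

theorem magCongr_one_four_decAvoidFour (k : ℕ) (w : List Bool) (b : Option (List Bool)) :
    MagCongr 1 4 (node (decAvoidFour k w) (decode (decAvoidFour 0) b))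
      (decAvoidFour k (w ++ evenFalse w :: codeTail b)) ∧
    ∀ p q, decAvoidFour k w = node p q →
      MagCongr 1 4 (node p (node q (decode (decAvoidFour 0) b)))
        (decAvoidFour k (w ++ (!evenFalse w) :: codeTail b)) := by
  induction w generalizing k with
  | nil =>
    refine ⟨?_, fun p q h => ?_⟩
    · simp only [List.nil_append, evenFalse, decAvoidFour, decAvoidFour_codeTail]
      exact .refl _
    · rw [decAvoidFour, node.injEq] at h
      obtain ⟨rfl, rfl⟩ := h
      simp only [List.nil_append, evenFalse, Bool.not_true, decAvoidFour, decAvoidFour_codeTail]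
      exact .refl _
  | cons c w ih =>
    cases c
    · refine ⟨?_, fun p q h => ?_⟩
      · rw [List.cons_append, decAvoidFour, decAvoidFour, evenFalse]
        obtain ⟨p, q, h⟩ := exists_decAvoidFour 0 w
        refine MagCongr.trans ?_ (((ih 0).2 p q h).node_right _)
        rw [h]
        exact (MagCongr.rule (i := 1) (j := 4) rfl _ p q _).symm
      · rw [decAvoidFour, node.injEq] at h
        obtain ⟨rfl, rfl⟩ := h
        rw [List.cons_append, decAvoidFour, evenFalse, Bool.not_not]
        exact (ih 0).1.node_right _
    · exact ih (k + 1)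

theorem classCount_one_four {n : ℕ} (hn : 2 ≤ n) :
    classCount (MagCongr 1 4) n = 2 ^ (n - 2) := by
  refine classCount_eq_of_code (op := opInsert evenFalse) rfl (decAvoidFour 0)
    (length_opInsert _) (fun x y z w => ?_)
    (code_decAvoidFour (opInsert_leftComb evenFalse_replicate_true) 0) (fun a b => ?_) hn
  · exact congrArg some (opInsert_evenFalse_rule _ _ _ _)
  · cases a with
    | none =>
      rw [opInsert, decAvoidFour_codeTail]
      exact .refl _
    | some v => exact (magCongr_one_four_decAvoidFour 0 v b).1

end AvoidFour

/-- For each of the seven quotients of the magmatic operad by one cubic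
relation, the number of classes of binary trees of arity `n ≥ 2` is `2^(n-2)`. -/
theorem stmt14 (i j : ℕ)
    (h : (i, j) ∈ [(1, 2), (4, 5), (1, 3), (3, 5), (1, 4), (2, 5), (2, 4)])
    (n : ℕ) (hn : 2 ≤ n) :
    classCount (MagCongr i j) n = 2 ^ (n - 2) := by
  simp only [List.mem_cons, Prod.mk.injEq, List.not_mem_nil, or_false] at h
  rcases h with ⟨rfl, rfl⟩ | ⟨rfl, rfl⟩ | ⟨rfl, rfl⟩ | ⟨rfl, rfl⟩ | ⟨rfl, rfl⟩ | ⟨rfl, rfl⟩ |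
    ⟨rfl, rfl⟩
  · exact (classCount_mirror (i := 4) (j := 5) rfl rfl rfl rfl n).trans (classCount_four_five hn)
  · exact classCount_four_five hn
  · exact classCount_one_three hn
  · exact (classCount_mirror (i := 1) (j := 3) rfl rfl rfl rfl n).trans (classCount_one_three hn)
  · exact classCount_one_four hn
  · exact (classCount_mirror (i := 1) (j := 4) rfl rfl rfl rfl n).trans (classCount_one_four hn)
  · exact classCount_two_four hn
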